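/- arXiv:2103.13066 — 6 statements merged into one kernel-verified Lean document; each statement's English description precedes it below -/
import Mathlib

section
/- There exists a constant C > 0 such that for every natural number N there is a finite set A of positive integers with |A| ≥ N satisfying s₊(A) ≤ C·|A|^{1/2}·log|A| and s₊ˣ(A) ≤ C·|A|^{2/3}; in particular max{s₊(A), s₊ˣ(A)} ≤ C·|A|^{2/3}. -/
open Finset

/-- A finite set `S ⊂ ℕ` is an additive Sidon set if the only solutions to
`a + b = c + d` with `a,b,c,d ∈ S` are the trivial ones with `{a,b} = {c,d}`. -/
def IsAddSidon (S : Finset ℕ) : Prop :=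
  ∀ a ∈ S, ∀ b ∈ S, ∀ c ∈ S, ∀ d ∈ S, a + b = c + d → ({a, b} : Finset ℕ) = {c, d}

/-- A finite set `S ⊂ ℕ` is a multiplicative Sidon set if the only solutions to
`a * b = c * d` with `a,b,c,d ∈ S` are the trivial ones with `{a,b} = {c,d}`. -/
def IsMulSidon (S : Finset ℕ) : Prop :=
  ∀ a ∈ S, ∀ b ∈ S, ∀ c ∈ S, ∀ d ∈ S, a * b = c * d → ({a, b} : Finset ℕ) = {c, d}

open scoped Classical in
/-- `sAdd A` is the size of the largest additive Sidon subset of `A`. -/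
noncomputable def sAdd (A : Finset ℕ) : ℕ :=
  (A.powerset.filter fun S => IsAddSidon S).sup Finset.card

open scoped Classical in
/-- `sMul A` is the size of the largest multiplicative Sidon subset of `A`. -/
noncomputable def sMul (A : Finset ℕ) : ℕ :=
  (A.powerset.filter fun S => IsMulSidon S).sup Finset.card

open scoped Classical in
lemma sAdd_le {A : Finset ℕ} {n : ℕ} (h : ∀ S ⊆ A, IsAddSidon S → S.card ≤ n) : sAdd A ≤ n :=
  Finset.sup_le fun S hS => h S (mem_powerset.1 (mem_filter.1 hS).1) (mem_filter.1 hS).2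

open scoped Classical in
lemma sMul_le {A : Finset ℕ} {n : ℕ} (h : ∀ S ⊆ A, IsMulSidon S → S.card ≤ n) : sMul A ≤ n :=
  Finset.sup_le fun S hS => h S (mem_powerset.1 (mem_filter.1 hS).1) (mem_filter.1 hS).2

/-- An additive Sidon subset of `[0, M]` has at most `√(2 (2M + 1))` elements. -/
lemma IsAddSidon.card_sq_le {S : Finset ℕ} (hS : IsAddSidon S) {M : ℕ} (hM : ∀ a ∈ S, a ≤ M) :
    S.card ^ 2 ≤ 2 * (2 * M + 1) := by
  have key : (S ×ˢ S).card ≤ 2 * (range (2 * M + 1)).card := by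
    refine card_le_mul_card_image_of_maps_to (f := fun p : ℕ × ℕ => p.1 + p.2) ?_ 2 ?_
    · intro p hp
      rw [mem_product] at hp
      have h₁ := hM _ hp.1
      have h₂ := hM _ hp.2
      exact mem_range.2 (by omega)
    · intro s _
      rcases (filter (fun p : ℕ × ℕ => p.1 + p.2 = s) (S ×ˢ S)).eq_empty_or_nonempty with h | ⟨p, hp⟩
      · simp [h]
      · refine (card_le_card (t := {p, p.swap}) ?_).trans card_le_two
        intro q hq
        simp only [mem_filter, mem_product] at hp hq
        have h := hS _ hq.1.1 _ hq.1.2 _ hp.1.1 _ hp.1.2 (hq.2.trans hp.2.symm)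
        have h₁ : q.1 ∈ ({p.1, p.2} : Finset ℕ) := h ▸ mem_insert_self _ _
        simp only [mem_insert, mem_singleton] at h₁ ⊢
        rcases h₁ with h₁ | h₁
        · exact Or.inl (Prod.ext h₁ (by omega))
        · exact Or.inr (Prod.ext h₁ (by simp only [Prod.snd_swap]; omega))
  simpa [sq] using key

/-- A multiplicative Sidon set contained in a product set `Y * X` of positive integers is the edge
set of a bipartite graph without quadrilaterals, so it has at most `|X| + |Y|²` elements. -/
lemma IsMulSidon.card_le_of_subset_image_mul {S X Y : Finset ℕ} (hS : IsMulSidon S)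
    (hX : ∀ x ∈ X, 0 < x) (hY : ∀ y ∈ Y, 0 < y)
    (hSXY : S ⊆ (Y ×ˢ X).image fun p => p.1 * p.2) :
    S.card ≤ X.card + Y.card ^ 2 := by
  have hrep : ∀ s ∈ S, ∃ p : ℕ × ℕ, p.1 ∈ Y ∧ p.2 ∈ X ∧ p.1 * p.2 = s := by
    intro s hs
    obtain ⟨p, hp, rfl⟩ := mem_image.1 (hSXY hs)
    exact ⟨p, (mem_product.1 hp).1, (mem_product.1 hp).2, rfl⟩
  choose! f hfY hfX hf using hrep
  have hbase : ∀ x, ∃ u, (∃ s ∈ S, (f s).2 = x) → u ∈ Y ∧ u * x ∈ S := by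
    intro x
    by_cases h : ∃ s ∈ S, (f s).2 = x
    · obtain ⟨s, hs, rfl⟩ := h
      exact ⟨(f s).1, fun _ => ⟨hfY s hs, (hf s hs).symm ▸ hs⟩⟩
    · exact ⟨0, fun h' => absurd h' h⟩
  choose u hu using hbase
  let g : ℕ → ℕ ⊕ ℕ × ℕ := fun s =>
    if (f s).1 = u (f s).2 then Sum.inl (f s).2 else Sum.inr (u (f s).2, (f s).1)
  have hmaps : ∀ s ∈ S, g s ∈ X.disjSum (Y ×ˢ Y) := by
    intro s hs
    by_cases h : (f s).1 = u (f s).2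
    · simpa [g, h] using hfX s hs
    · simpa [g, h] using ⟨(hu _ ⟨s, hs, rfl⟩).1, hfY s hs⟩
  have hinj : Set.InjOn g S := by
    intro s hs t ht hst
    have hs' := hf s hs
    have ht' := hf t ht
    by_cases h₁ : (f s).1 = u (f s).2 <;> by_cases h₂ : (f t).1 = u (f t).2
    · have hx : (f s).2 = (f t).2 := by simpa [g, h₁, h₂] using hst
      rw [← hs', ← ht', h₁, h₂, hx]
    · simp [g, h₁, h₂] at hst
    · simp [g, h₁, h₂] at hst
    · have hst' : u (f s).2 = u (f t).2 ∧ (f s).1 = (f t).1 := by simpa [g, h₁, h₂] using hst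
      obtain ⟨huY, hus⟩ := hu _ ⟨s, hs, rfl⟩
      have hut := (hu _ ⟨t, ht, rfl⟩).2
      have hpair := hS _ hus _ ht _ hut _ hs (by
        calc u (f s).2 * (f s).2 * t = u (f s).2 * (f s).2 * ((f t).1 * (f t).2) := by rw [ht']
          _ = u (f t).2 * (f t).2 * ((f s).1 * (f s).2) := by rw [hst'.1, hst'.2]; ring
          _ = u (f t).2 * (f t).2 * s := by rw [hs'])
      have hmem : u (f s).2 * (f s).2 ∈ ({u (f t).2 * (f t).2, s} : Finset ℕ) :=
        hpair ▸ mem_insert_self _ _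
      rw [mem_insert, mem_singleton, ← hst'.1] at hmem
      rcases hmem with h | h
      · rw [← hs', ← ht', hst'.2, Nat.eq_of_mul_eq_mul_left (hY _ huY) h]
      · exact absurd (Nat.eq_of_mul_eq_mul_right (hX _ (hfX s hs)) (hs'.trans h.symm)) h₁
  simpa [sq] using card_le_card_of_injOn g hmaps hinj

/-- A Chebyshev-type upper bound for the `m`-th prime. -/
lemma nth_prime_le_mul_log (m : ℕ) :
    (Nat.nth Nat.Prime m : ℝ) ≤ 12 * (m + 1) * Real.log (12 * (m + 1)) := by
  have hprime := Nat.prime_nth_prime m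
  set p := Nat.nth Nat.Prime m with hp
  have hp2 : (2 : ℝ) ≤ p := mod_cast hprime.two_le
  have hpi : p.primeCounting = m + 1 := by
    rw [Nat.primeCounting, Nat.primeCounting', hp, Nat.count_succ, if_pos hprime,
      Nat.count_nth_of_infinite Nat.infinite_setOfPred_prime]
  have hψ : p * Real.log 2 - Real.log (p + 1) ≤ (m + 1) * Real.log p := by
    have := (Chebyshev.psi_ge p).trans (Chebyshev.psi_le_primeCounting_mul_log p)
    rw [hpi] at this
    exact_mod_cast this
  have hlogp : 0 < Real.log p := Real.log_pos (by linarith)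
  have hlog_succ : Real.log (p + 1) ≤ 2 * Real.log p := by
    have h : Real.log (p + 1) ≤ Real.log ((p : ℝ) ^ 2) :=
      Real.log_le_log (by linarith) (by nlinarith)
    simpa [Real.log_pow] using h
  have hm : (0 : ℝ) ≤ m := Nat.cast_nonneg m
  have hple : (p : ℝ) ≤ 6 * (m + 1) * Real.log p := by
    nlinarith [Real.log_two_gt_d9, mul_nonneg hm hlogp.le]
  have hsqrt : 0 < √(p : ℝ) := Real.sqrt_pos.2 (by linarith)
  have hsq : √(p : ℝ) * √(p : ℝ) = p := Real.mul_self_sqrt (by linarith)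
  have hlog_sqrt : Real.log p = 2 * Real.log √(p : ℝ) := by
    rw [Real.log_sqrt (by linarith)]; ring
  have hlog_lt : Real.log √(p : ℝ) ≤ √(p : ℝ) := (Real.log_le_sub_one_of_pos hsqrt).trans (by linarith)
  have hsqrt_le : √(p : ℝ) ≤ 12 * (m + 1) := by
    refine le_of_mul_le_mul_right ?_ hsqrt
    nlinarith
  have hlog_le : Real.log √(p : ℝ) ≤ Real.log (12 * (m + 1)) := Real.log_le_log hsqrt hsqrt_le
  nlinarith

/-- Products of one of the first `Q` primes with one of the next `Q ^ 2` primes. -/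
noncomputable def primeProducts (Q : ℕ) : Finset ℕ :=
  ((range Q).image (Nat.nth Nat.Prime) ×ˢ (Ico Q (Q + Q ^ 2)).image (Nat.nth Nat.Prime)).image
    fun p => p.1 * p.2

lemma mem_primeProducts {Q a : ℕ} : a ∈ primeProducts Q ↔
    ∃ i < Q, ∃ j, Q ≤ j ∧ j < Q + Q ^ 2 ∧ Nat.nth Nat.Prime i * Nat.nth Nat.Prime j = a := by
  simp [primeProducts, and_assoc]

lemma nth_prime_injective : Function.Injective (Nat.nth Nat.Prime) :=
  Nat.nth_injective Nat.infinite_setOfPred_prime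

lemma card_primeProducts (Q : ℕ) : (primeProducts Q).card = Q ^ 3 := by
  rw [primeProducts, card_image_of_injOn, card_product, card_image_of_injective _ nth_prime_injective,
    card_image_of_injective _ nth_prime_injective]
  · simp
    ring
  · rintro ⟨a, b⟩ hab ⟨c, d⟩ hcd h
    simp only [coe_product, coe_image, coe_range, coe_Ico, Set.mem_prod, Set.mem_image, Set.mem_Iio,
      Set.mem_Ico] at hab hcd
    obtain ⟨⟨i, hi, rfl⟩, j, hj, rfl⟩ := hab
    obtain ⟨⟨k, hk, rfl⟩, l, hl, rfl⟩ := hcd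
    dsimp only at h
    have hdvd : Nat.nth Nat.Prime i ∣ Nat.nth Nat.Prime k * Nat.nth Nat.Prime l :=
      h ▸ Dvd.intro _ rfl
    rcases (Nat.prime_nth_prime i).dvd_mul.1 hdvd with h' | h'
    · have hik := (Nat.prime_dvd_prime_iff_eq (Nat.prime_nth_prime i) (Nat.prime_nth_prime k)).1 h'
      rw [hik] at h ⊢
      rw [Nat.eq_of_mul_eq_mul_left (Nat.prime_nth_prime k).pos h]
    · have hil := nth_prime_injective
        ((Nat.prime_dvd_prime_iff_eq (Nat.prime_nth_prime i) (Nat.prime_nth_prime l)).1 h')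
      omega

lemma sMul_primeProducts_le (Q : ℕ) : sMul (primeProducts Q) ≤ 2 * Q ^ 2 := by
  refine sMul_le fun S hSA hS => ?_
  refine (hS.card_le_of_subset_image_mul ?_ ?_ hSA).trans (le_of_eq ?_)
  · simp only [mem_image]
    rintro _ ⟨i, _, rfl⟩
    exact (Nat.prime_nth_prime i).pos
  · simp only [mem_image]
    rintro _ ⟨i, _, rfl⟩
    exact (Nat.prime_nth_prime i).pos
  · rw [card_image_of_injective _ nth_prime_injective, card_image_of_injective _ nth_prime_injective]
    simp
    ring

lemma le_of_mem_primeProducts {Q a : ℕ} (hQ : 24 ≤ Q) (ha : a ∈ primeProducts Q) :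
    (a : ℝ) ≤ 1728 * Q ^ 3 * Real.log Q ^ 2 := by
  obtain ⟨i, hi, j, -, hj, rfl⟩ := mem_primeProducts.1 ha
  have hQ' : (24 : ℝ) ≤ Q := mod_cast hQ
  have hi' : (i : ℝ) + 1 ≤ Q := mod_cast hi
  have hj' : (j : ℝ) + 1 ≤ 2 * Q ^ 2 := by
    have : (j : ℝ) + 1 ≤ Q + Q ^ 2 := mod_cast hj
    nlinarith
  have hlogi : Real.log (12 * (i + 1)) ≤ 2 * Real.log Q := by
    have h : Real.log (12 * (i + 1)) ≤ Real.log ((Q : ℝ) ^ 2) :=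
      Real.log_le_log (by positivity) (by nlinarith)
    simpa [Real.log_pow] using h
  have hlogj : Real.log (12 * (j + 1)) ≤ 3 * Real.log Q := by
    have h : Real.log (12 * (j + 1)) ≤ Real.log ((Q : ℝ) ^ 3) :=
      Real.log_le_log (by positivity) (by nlinarith [sq_nonneg (Q : ℝ)])
    simpa [Real.log_pow] using h
  have hlogQ : 0 ≤ Real.log Q := Real.log_nonneg (by linarith)
  have h₁ : (Nat.nth Nat.Prime i : ℝ) ≤ 12 * Q * (2 * Real.log Q) := by
    refine (nth_prime_le_mul_log i).trans (mul_le_mul (by gcongr) hlogi ?_ (by positivity))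
    exact Real.log_nonneg (by linarith [(Nat.cast_nonneg i : (0 : ℝ) ≤ i)])
  have h₂ : (Nat.nth Nat.Prime j : ℝ) ≤ 12 * (2 * Q ^ 2) * (3 * Real.log Q) := by
    refine (nth_prime_le_mul_log j).trans (mul_le_mul (by gcongr) hlogj ?_ (by positivity))
    exact Real.log_nonneg (by linarith [(Nat.cast_nonneg j : (0 : ℝ) ≤ j)])
  push_cast
  calc (Nat.nth Nat.Prime i : ℝ) * Nat.nth Nat.Prime j
      ≤ (12 * Q * (2 * Real.log Q)) * (12 * (2 * Q ^ 2) * (3 * Real.log Q)) := by gcongr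
    _ = 1728 * Q ^ 3 * Real.log Q ^ 2 := by ring

lemma sAdd_primeProducts_le {Q : ℕ} (hQ : 24 ≤ Q) :
    (sAdd (primeProducts Q) : ℝ) ≤ 120 * √((Q : ℝ) ^ 3) * Real.log Q := by
  have hQ' : (24 : ℝ) ≤ Q := mod_cast hQ
  have hlogQ : 1 ≤ Real.log Q := by
    rw [Real.le_log_iff_exp_le (by linarith)]
    linarith [Real.exp_one_lt_d9]
  set B : ℝ := 1728 * Q ^ 3 * Real.log Q ^ 2 with hB
  have hB1 : 1 ≤ B := by
    have h₁ : (1 : ℝ) ≤ (Q : ℝ) ^ 3 := one_le_pow₀ (by linarith)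
    have h₂ : (1 : ℝ) ≤ Real.log Q ^ 2 := one_le_pow₀ hlogQ
    nlinarith
  have hsq : sAdd (primeProducts Q) ^ 2 ≤ 2 * (2 * ⌊B⌋₊ + 1) :=
    Nat.le_sqrt'.1 <| sAdd_le fun S hSA hS => Nat.le_sqrt'.2 <|
      hS.card_sq_le fun a ha => Nat.le_floor (le_of_mem_primeProducts hQ (hSA ha))
  have hsq' : (sAdd (primeProducts Q) : ℝ) ^ 2 ≤ 2 * (2 * ⌊B⌋₊ + 1) := mod_cast hsq
  have hfloor : (⌊B⌋₊ : ℝ) ≤ B := Nat.floor_le (by linarith)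
  refine (sq_le_sq₀ (Nat.cast_nonneg _) (by positivity)).1 ?_
  rw [mul_pow, mul_pow, Real.sq_sqrt (by positivity)]
  nlinarith

theorem stmt0 :
    ∃ C : ℝ, 0 < C ∧ ∀ N : ℕ, ∃ A : Finset ℕ,
      (∀ a ∈ A, 0 < a) ∧ N ≤ A.card ∧
      (sAdd A : ℝ) ≤ C * (A.card : ℝ) ^ ((1 : ℝ) / 2) * Real.log (A.card) ∧
      (sMul A : ℝ) ≤ C * (A.card : ℝ) ^ ((2 : ℝ) / 3) ∧
      (max (sAdd A) (sMul A) : ℝ) ≤ C * (A.card : ℝ) ^ ((2 : ℝ) / 3) := by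
  refine ⟨800, by norm_num, fun N => ?_⟩
  obtain ⟨Q, hQ, hNQ⟩ : ∃ Q, 24 ≤ Q ∧ N ≤ Q := ⟨max 24 N, le_max_left _ _, le_max_right _ _⟩
  have hQ1 : (1 : ℝ) ≤ Q := by exact_mod_cast (by omega : 1 ≤ Q)
  have hQ0 : (0 : ℝ) ≤ Q := by linarith
  have hlogQ : 0 ≤ Real.log Q := Real.log_nonneg hQ1
  have hpow_half : (((Q ^ 3 : ℕ) : ℝ)) ^ ((1 : ℝ) / 2) = √((Q : ℝ) ^ 3) := by
    rw [← Real.sqrt_eq_rpow, Nat.cast_pow]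
  have hpow_two_thirds : (((Q ^ 3 : ℕ) : ℝ)) ^ ((2 : ℝ) / 3) = (Q : ℝ) ^ 2 := by
    rw [Nat.cast_pow, ← Real.rpow_natCast, ← Real.rpow_mul hQ0, ← Real.rpow_natCast]
    norm_num
  have hlog : Real.log ((Q ^ 3 : ℕ) : ℝ) = 3 * Real.log Q := by
    rw [Nat.cast_pow, Real.log_pow]
    norm_num
  have hadd := sAdd_primeProducts_le hQ
  have hmul : (sMul (primeProducts Q) : ℝ) ≤ 2 * (Q : ℝ) ^ 2 := mod_cast sMul_primeProducts_le Q
  have hsqrt_mul_log : √((Q : ℝ) ^ 3) * Real.log Q ≤ 2 * (Q : ℝ) ^ 2 := by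
    have hs : 0 < √(Q : ℝ) := Real.sqrt_pos.2 (by linarith)
    have hcube : √((Q : ℝ) ^ 3) = Q * √(Q : ℝ) := by
      rw [pow_succ, Real.sqrt_mul (by positivity), Real.sqrt_sq hQ0]
    have hlog_le : Real.log Q ≤ 2 * √(Q : ℝ) := by
      have h := Real.log_le_sub_one_of_pos hs
      rw [Real.log_sqrt hQ0] at h
      linarith
    calc √((Q : ℝ) ^ 3) * Real.log Q ≤ Q * √(Q : ℝ) * (2 * √(Q : ℝ)) := by rw [hcube]; gcongr
      _ = 2 * Q * (√(Q : ℝ) * √(Q : ℝ)) := by ring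
      _ = 2 * (Q : ℝ) ^ 2 := by rw [Real.mul_self_sqrt hQ0]; ring
  refine ⟨primeProducts Q, fun a ha => ?_, ?_, ?_, ?_, ?_⟩
  · obtain ⟨i, -, j, -, -, rfl⟩ := mem_primeProducts.1 ha
    exact Nat.mul_pos (Nat.prime_nth_prime i).pos (Nat.prime_nth_prime j).pos
  · rw [card_primeProducts]
    exact hNQ.trans (Nat.le_self_pow (by norm_num) Q)
  · rw [card_primeProducts, hpow_half, hlog]
    have : 0 ≤ √((Q : ℝ) ^ 3) * Real.log Q := by positivity
    linarith
  · rw [card_primeProducts, hpow_two_thirds]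
    nlinarith
  · rw [card_primeProducts, hpow_two_thirds]
    exact max_le (by nlinarith) (by nlinarith)
end

section
/- There exists a constant C > 0 such that for every natural number N there is a finite set A of positive integers with |A| ≥ N satisfying |A+A| ≤ C·|A|·(log|A|)² and s₊ˣ(A) ≤ C·|A|^{2/3}. -/
open Finset Pointwise

/-- A multiplicative Sidon subset of a product set `P * Q` has at most `|Q| + |P|²` elements. -/
theorem IsMulSidon.card_le {P Q S : Finset ℕ} (hS : IsMulSidon S) (hSPQ : S ⊆ P * Q) :
    S.card ≤ Q.card + P.card * P.card := by
  classical
  have hrep : ∀ s ∈ S, ∃ x : ℕ × ℕ, x.1 ∈ P ∧ x.2 ∈ Q ∧ x.1 * x.2 = s := fun s hs ↦ by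
    obtain ⟨a, ha, b, hb, hab⟩ := Finset.mem_mul.mp (hSPQ hs)
    exact ⟨(a, b), ha, hb, hab⟩
  choose! f hfP hfQ hf using hrep
  have hsec : ∀ q ∈ S.image (fun s ↦ (f s).2), ∃ s ∈ S, (f s).2 = q := fun q hq ↦ by
    simpa using hq
  choose! r hrS hr using hsec
  have hmem : ∀ s ∈ S, (f s).2 ∈ S.image (fun s ↦ (f s).2) := fun s hs ↦
    Finset.mem_image_of_mem (fun s ↦ (f s).2) hs
  let R := (S.image fun s ↦ (f s).2).image r
  have hR : R.card ≤ Q.card :=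
    Finset.card_image_le.trans <| Finset.card_le_card <| by
      intro q hq
      obtain ⟨s, hs, rfl⟩ := Finset.mem_image.mp hq
      exact hfQ s hs
  have hSR : (S \ R).card ≤ (P ×ˢ P).card := by
    refine Finset.card_le_card_of_injOn (fun s ↦ ((f s).1, (f (r (f s).2)).1)) ?_ ?_
    · intro s hs
      have hs' := (Finset.mem_sdiff.mp (Finset.mem_coe.mp hs)).1
      exact Finset.mem_coe.mpr <|
        Finset.mem_product.mpr ⟨hfP s hs', hfP _ (hrS _ (hmem s hs'))⟩
    · intro s hs t ht hst
      obtain ⟨hs, hsR⟩ := Finset.mem_sdiff.mp (Finset.mem_coe.mp hs)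
      obtain ⟨ht, -⟩ := Finset.mem_sdiff.mp (Finset.mem_coe.mp ht)
      obtain ⟨h1, h2⟩ := Prod.mk.inj hst
      have hs0 := hf _ (hrS _ (hmem s hs))
      have ht0 := hf _ (hrS _ (hmem t ht))
      rw [hr _ (hmem s hs)] at hs0
      rw [hr _ (hmem t ht)] at ht0
      have key : s * r (f t).2 = t * r (f s).2 := by
        calc s * r (f t).2
            = ((f s).1 * (f s).2) * ((f (r (f t).2)).1 * (f t).2) := by rw [hf s hs, ht0]
          _ = ((f t).1 * (f t).2) * ((f (r (f s).2)).1 * (f s).2) := by rw [h1, h2]; ring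
          _ = t * r (f s).2 := by rw [hf t ht, hs0]
      have hpair := hS s hs _ (hrS _ (hmem t ht)) t ht _ (hrS _ (hmem s hs)) key
      have hs_mem : s ∈ ({t, r (f s).2} : Finset ℕ) := hpair ▸ Finset.mem_insert_self _ _
      rcases Finset.mem_insert.mp hs_mem with h | h
      · exact h
      · refine absurd ?_ hsR
        rw [Finset.mem_singleton.mp h]
        exact Finset.mem_image_of_mem r (hmem s hs)
  calc S.card ≤ (S \ R).card + R.card := by
        have := Finset.le_card_sdiff R S
        omega
    _ ≤ Q.card + P.card * P.card := by
        rw [Finset.card_product] at hSR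
        omega

theorem sMul_mul_le (P Q : Finset ℕ) : sMul (P * Q) ≤ Q.card + P.card * P.card := by
  classical
  refine Finset.sup_le fun S hS ↦ ?_
  obtain ⟨hS, hSidon⟩ := Finset.mem_filter.mp hS
  exact hSidon.card_le (Finset.mem_powerset.mp hS)

/-- A positive integer at most `y ^ k` has at most `k` prime factors that are at least `y`. -/
theorem card_le_of_primes_dvd {D : Finset ℕ} {m y k : ℕ} (hy : 2 ≤ y) (hm : 0 < m)
    (hmy : m ≤ y ^ k) (hD : ∀ p ∈ D, p.Prime ∧ y ≤ p ∧ p ∣ m) : D.card ≤ k := by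
  have hprod : ∏ p ∈ D, p ∣ m :=
    Finset.prod_primes_dvd m (fun p hp ↦ (hD p hp).1.prime) fun p hp ↦ (hD p hp).2.2
  have hpow : y ^ D.card ≤ y ^ k :=
    (Finset.pow_card_le_prod D id y fun p hp ↦ (hD p hp).2.1).trans <|
      (Nat.le_of_dvd hm hprod).trans hmy
  exact (Nat.pow_le_pow_iff_right (by omega)).mp hpow

/-- If `P` consists of primes at least `y`, elements of `P * Q` below `y ^ k` have few
representations as products. -/
theorem card_mul_card_le_of_primes {P Q : Finset ℕ} {y k : ℕ} (hy : 2 ≤ y)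
    (hP : ∀ p ∈ P, p.Prime ∧ y ≤ p) (hQ : ∀ q ∈ Q, 0 < q)
    (hPQ : ∀ m ∈ P * Q, m ≤ y ^ k) : P.card * Q.card ≤ k * (P * Q).card := by
  classical
  rw [← Finset.card_product, ← Finset.image_mul_product]
  refine Finset.card_le_mul_card_image _ _ fun m hm ↦ ?_
  rw [Finset.image_mul_product] at hm
  have hm0 : 0 < m := by
    obtain ⟨p, hp, q, hq, rfl⟩ := Finset.mem_mul.mp hm
    exact Nat.mul_pos (hP p hp).1.pos (hQ q hq)
  rw [← Finset.card_image_of_injOn (f := Prod.fst)]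
  · refine card_le_of_primes_dvd hy hm0 (hPQ m hm) fun p hp ↦ ?_
    obtain ⟨⟨p, q⟩, hx, rfl⟩ := Finset.mem_image.mp hp
    obtain ⟨hx, hpq⟩ := Finset.mem_filter.mp hx
    obtain ⟨hp, -⟩ := Finset.mem_product.mp hx
    exact ⟨(hP p hp).1, (hP p hp).2, Dvd.intro q hpq⟩
  · rintro ⟨p, q⟩ hx ⟨p', q'⟩ hx' (rfl : p = p')
    obtain ⟨hx, hpq⟩ := Finset.mem_filter.mp (Finset.mem_coe.mp hx)
    obtain ⟨-, hpq'⟩ := Finset.mem_filter.mp (Finset.mem_coe.mp hx')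
    have hp := (hP p (Finset.mem_product.mp hx).1).1.pos
    exact Prod.ext rfl (Nat.eq_of_mul_eq_mul_left hp (hpq.trans hpq'.symm))

theorem eventually_log_le_div_ten : ∀ᶠ y : ℕ in Filter.atTop, Real.log y ≤ (y : ℝ) / 10 := by
  have h := (Real.isLittleO_log_id_atTop.bound (c := 1 / 10) (by norm_num)).and
    (Filter.eventually_ge_atTop 0)
  filter_upwards [tendsto_natCast_atTop_atTop.eventually h] with y hy
  obtain ⟨hy, hy0⟩ := hy
  rw [id, Real.norm_of_nonneg hy0] at hy
  linarith [Real.le_norm_self (Real.log y)]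

/-- The number of primes in `(y, y²]` is `≫ y² / log y`. -/
theorem sq_le_card_primes_mul_log {y : ℕ} (hy : 3 ≤ y) (hlog : Real.log y ≤ (y : ℝ) / 10) :
    (y : ℝ) ^ 2 ≤ 8 * (((Finset.Ioc y (y ^ 2)).filter Nat.Prime).card : ℝ) * Real.log y := by
  have hy' : (3 : ℝ) ≤ y := by exact_mod_cast hy
  have hlogpos : 0 < Real.log y := Real.log_pos (by linarith)
  have hcount : Nat.primeCounting (y ^ 2) ≤
      ((Finset.Ioc y (y ^ 2)).filter Nat.Prime).card + y := by
    rw [← Nat.primesLE_card_eq_primeCounting]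
    calc (Nat.primesLE (y ^ 2)).card
        ≤ ((Finset.Ioc y (y ^ 2)).filter Nat.Prime ∪ Finset.Ioc 0 y).card := by
          refine Finset.card_le_card fun p hp ↦ ?_
          rw [Nat.mem_primesLE] at hp
          have := hp.2.pos
          simp only [Finset.mem_union, Finset.mem_filter, Finset.mem_Ioc]
          by_cases h : p ≤ y
          · exact Or.inr ⟨this, h⟩
          · exact Or.inl ⟨⟨by omega, hp.1⟩, hp.2⟩
      _ ≤ _ := by simpa using Finset.card_union_le _ (Finset.Ioc 0 y)
  have hcount' : (Nat.primeCounting (y ^ 2) : ℝ) ≤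
      ((Finset.Ioc y (y ^ 2)).filter Nat.Prime).card + y := by exact_mod_cast hcount
  have hpi := Chebyshev.pi_ge (y ^ 2)
  push_cast at hpi
  rw [Real.log_pow, div_le_iff₀ (by positivity)] at hpi
  push_cast at hpi
  have hlog3 : Real.log ((y : ℝ) ^ 2 + 1) ≤ 3 * Real.log y := by
    have : Real.log ((y : ℝ) ^ 3) = 3 * Real.log y := by rw [Real.log_pow]; norm_num
    rw [← this]
    exact Real.log_le_log (by positivity) (by nlinarith [sq_nonneg (y : ℝ)])
  have h2 := mul_le_mul_of_nonneg_right hcount' hlogpos.le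
  have h3 := mul_le_mul_of_nonneg_left hlog (by positivity : (0 : ℝ) ≤ y)
  have h4 := mul_le_mul_of_nonneg_left Real.log_two_gt_d9.le (sq_nonneg (y : ℝ))
  nlinarith

theorem stmt1 :
    ∃ C : ℝ, 0 < C ∧ ∀ N : ℕ, ∃ A : Finset ℕ,
      (∀ a ∈ A, 0 < a) ∧ N ≤ A.card ∧
      ((A + A).card : ℝ) ≤ C * (A.card : ℝ) * (Real.log (A.card)) ^ 2 ∧
      (sMul A : ℝ) ≤ C * (A.card : ℝ) ^ ((2 : ℝ) / 3) := by
  refine ⟨96, by norm_num, fun N ↦ ?_⟩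
  obtain ⟨y, hlog, hy, hyN⟩ := (eventually_log_le_div_ten.and <|
    (Filter.eventually_ge_atTop 3).and (Filter.eventually_ge_atTop N)).exists
  have hdense := sq_le_card_primes_mul_log hy hlog
  set P := (Finset.Ioc y (y ^ 2)).filter Nat.Prime with hPdef
  set n := P.card with hn
  have hP : ∀ p ∈ P, p.Prime ∧ y ≤ p ∧ p ≤ y ^ 2 := fun p hp ↦ by
    obtain ⟨hp, hpp⟩ := Finset.mem_filter.mp hp
    obtain ⟨h1, h2⟩ := Finset.mem_Ioc.mp hp
    exact ⟨hpp, h1.le, h2⟩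
  have hny2 : n ≤ y ^ 2 := by
    calc n ≤ (Finset.Ioc y (y ^ 2)).card := Finset.card_filter_le _ _
      _ ≤ y ^ 2 := by simp
  have hy' : (3 : ℝ) ≤ y := by exact_mod_cast hy
  have hny : y ≤ n := by
    have h := mul_le_mul_of_nonneg_left hlog (by positivity : (0 : ℝ) ≤ 8 * n)
    have : (y : ℝ) ≤ n := by
      by_contra! hlt
      nlinarith [Nat.cast_nonneg (α := ℝ) n]
    exact_mod_cast this
  set Q := Finset.Icc 1 (n ^ 2) with hQdef
  have hQcard : Q.card = n ^ 2 := by simp [hQdef]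
  have hle : ∀ m ∈ P * Q, 0 < m ∧ m ≤ y ^ 2 * n ^ 2 := fun m hm ↦ by
    obtain ⟨p, hp, q, hq, rfl⟩ := Finset.mem_mul.mp hm
    obtain ⟨hq1, hq2⟩ := Finset.mem_Icc.mp hq
    exact ⟨Nat.mul_pos (hP p hp).1.pos hq1, Nat.mul_le_mul (hP p hp).2.2 hq2⟩
  have hcard : n ^ 3 ≤ 6 * (P * Q).card := by
    have h := card_mul_card_le_of_primes (P := P) (Q := Q) (y := y) (k := 6) (by omega)
      (fun p hp ↦ ⟨(hP p hp).1, (hP p hp).2.1⟩) (fun q hq ↦ (Finset.mem_Icc.mp hq).1)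
      fun m hm ↦ (hle m hm).2.trans <| by
        calc y ^ 2 * n ^ 2 ≤ y ^ 2 * (y ^ 2) ^ 2 := by gcongr
          _ = y ^ 6 := by ring
    rw [hQcard] at h
    calc n ^ 3 = P.card * n ^ 2 := by rw [← hn]; ring
      _ ≤ _ := h
  have hyA : y ≤ (P * Q).card := by
    have h1 : y ^ 3 ≤ n ^ 3 := Nat.pow_le_pow_left hny 3
    have h2 : 9 * y ≤ y ^ 3 := by nlinarith [Nat.mul_le_mul hy hy]
    omega
  have hsum : (P * Q + P * Q).card ≤ 2 * (y ^ 2 * n ^ 2) := by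
    calc (P * Q + P * Q).card ≤ (Finset.Ioc 0 (2 * (y ^ 2 * n ^ 2))).card := by
          refine Finset.card_le_card fun m hm ↦ ?_
          obtain ⟨a, ha, b, hb, rfl⟩ := Finset.mem_add.mp hm
          have := hle a ha
          have := hle b hb
          rw [Finset.mem_Ioc]
          omega
      _ = _ := by simp
  have hsidon : sMul (P * Q) ≤ 2 * n ^ 2 := by
    have h := sMul_mul_le P Q
    rw [hQcard, ← hn] at h
    linarith [sq n]
  refine ⟨P * Q, fun a ha ↦ (hle a ha).1, hyN.trans hyA, ?_, ?_⟩
  · set A := P * Q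
    have hA : (y : ℝ) ≤ A.card := by exact_mod_cast hyA
    have hcardR : (n : ℝ) ^ 3 ≤ 6 * A.card := by exact_mod_cast hcard
    have hlogA : Real.log y ≤ Real.log A.card := Real.log_le_log (by linarith) hA
    have hlogy : 1 ≤ Real.log y := by
      rw [Real.le_log_iff_exp_le (by linarith)]
      linarith [Real.exp_one_lt_d9]
    calc ((A + A).card : ℝ) ≤ 2 * ((y : ℝ) ^ 2 * n ^ 2) := by exact_mod_cast hsum
      _ ≤ 2 * ((8 * n * Real.log y) * n ^ 2) := by gcongr
      _ = 16 * (n : ℝ) ^ 3 * Real.log y := by ring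
      _ ≤ 16 * (6 * A.card) * Real.log A.card ^ 2 := by
        gcongr
        nlinarith
      _ = 96 * A.card * Real.log A.card ^ 2 := by ring
  · set A := P * Q
    have hcardR : (n : ℝ) ^ 3 ≤ 6 * A.card := by exact_mod_cast hcard
    have hsq : (n : ℝ) ^ 2 = ((n : ℝ) ^ 3) ^ ((2 : ℝ) / 3) := by
      rw [← Real.rpow_natCast _ 3, ← Real.rpow_mul (by positivity), ← Real.rpow_natCast]
      norm_num
    have h6 : (6 : ℝ) ^ ((2 : ℝ) / 3) ≤ 6 := by
      simpa using Real.rpow_le_rpow_of_exponent_le (x := 6) (by norm_num)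
        (by norm_num : (2 : ℝ) / 3 ≤ 1)
    calc (sMul A : ℝ) ≤ 2 * (n : ℝ) ^ 2 := by exact_mod_cast hsidon
      _ ≤ 2 * (6 * A.card : ℝ) ^ ((2 : ℝ) / 3) := by rw [hsq]; gcongr
      _ = 2 * (6 ^ ((2 : ℝ) / 3) * (A.card : ℝ) ^ ((2 : ℝ) / 3)) := by
        rw [Real.mul_rpow (by norm_num) (by positivity)]
      _ ≤ 2 * (6 * (A.card : ℝ) ^ ((2 : ℝ) / 3)) := by gcongr
      _ ≤ 96 * (A.card : ℝ) ^ ((2 : ℝ) / 3) := by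
        have : (0 : ℝ) ≤ (A.card : ℝ) ^ ((2 : ℝ) / 3) := by positivity
        linarith
end

section
/- Let P and Q be finite sets and let E ⊆ P × Q be such that E contains no copy of C₄, i.e. for all p, p' ∈ P with p ≠ p' and all q, q' ∈ Q with q ≠ q', it is not the case that all four pairs (p,q), (p,q'), (p',q), (p',q') lie in E. Then |E|² ≤ |Q|·(|E| + |P|²). -/
open Finset

/-- Cauchy–Schwarz: the square of the size of a set is at most the number of values of `f` times
the number of pairs on which `f` agrees. -/
theorem card_sq_le_card_mul_card_filter_eq {γ β : Type*} [DecidableEq β]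
    (E : Finset γ) (Q : Finset β) (f : γ → β) (hf : ∀ e ∈ E, f e ∈ Q) :
    E.card ^ 2 ≤ Q.card * ((E ×ˢ E).filter fun x => f x.1 = f x.2).card := by
  have hS : ((E ×ˢ E).filter fun x => f x.1 = f x.2).card
      = ∑ q ∈ Q, (E.filter fun e => f e = q).card ^ 2 := by
    rw [card_eq_sum_card_fiberwise (f := fun x => f x.1) (t := Q)]
    · refine sum_congr rfl fun q _ => ?_
      rw [sq, ← card_product]
      congr 1
      ext x
      simp only [mem_filter, mem_product]
      grind
    · intro x hx
      simp only [coe_filter, mem_product, Set.mem_ofPred_eq] at hx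
      exact hf _ hx.1.1
  rw [hS, card_eq_sum_card_fiberwise (f := f) (t := Q) hf]
  exact sq_sum_le_card_mul_sum_sq

theorem stmt6 {α β : Type*} [DecidableEq α] [DecidableEq β]
    (P : Finset α) (Q : Finset β) (E : Finset (α × β)) (hE : E ⊆ P ×ˢ Q)
    (hC4 : ∀ p ∈ P, ∀ p' ∈ P, p ≠ p' → ∀ q ∈ Q, ∀ q' ∈ Q, q ≠ q' →
      ¬ ((p, q) ∈ E ∧ (p, q') ∈ E ∧ (p', q) ∈ E ∧ (p', q') ∈ E)) :
    E.card ^ 2 ≤ Q.card * (E.card + P.card ^ 2) := by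
  have hmem : ∀ e ∈ E, e.1 ∈ P ∧ e.2 ∈ Q := fun e he => mem_product.1 (hE he)
  refine (card_sq_le_card_mul_card_filter_eq E Q Prod.snd fun e he => (hmem e he).2).trans
    (Nat.mul_le_mul_left _ ?_)
  rw [← card_filter_add_card_filter_not (fun x : (α × β) × (α × β) => x.1.1 = x.2.1)]
  refine add_le_add ?_ ?_
  · refine card_le_card_of_injOn Prod.fst ?_ ?_
    · rintro x hx
      simp only [coe_filter, mem_filter, mem_product, Set.mem_ofPred_eq] at hx
      exact hx.1.1.1
    · rintro ⟨⟨a, b⟩, c, d⟩ hx ⟨⟨a', b'⟩, c', d'⟩ hy h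
      simp only [coe_filter, mem_filter, mem_product, Set.mem_ofPred_eq] at hx hy
      grind
  · rw [sq, ← card_product]
    refine card_le_card_of_injOn (fun x => (x.1.1, x.2.1)) ?_ ?_
    · rintro x hx
      simp only [coe_filter, mem_filter, mem_product, Set.mem_ofPred_eq] at hx
      exact mem_product.2 ⟨(hmem _ hx.1.1.1).1, (hmem _ hx.1.1.2).1⟩
    · rintro ⟨⟨p, q⟩, p', r⟩ hx ⟨⟨s, q'⟩, s', r'⟩ hy h
      simp only [coe_filter, mem_filter, mem_product, Set.mem_ofPred_eq] at hx hy
      obtain ⟨⟨⟨hpq, hpq'⟩, rfl⟩, hne⟩ := hx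
      obtain ⟨⟨⟨hsq, hsq'⟩, rfl⟩, -⟩ := hy
      obtain ⟨rfl, rfl⟩ := Prod.mk.inj h
      by_cases hq : q = q'
      · rw [hq]
      · exact absurd ⟨hpq, hsq, hpq', hsq'⟩ (hC4 p (hmem _ hpq).1 p' (hmem _ hpq').1 hne
          q (hmem _ hpq).2 q' (hmem _ hsq).2 hq)
end

section
/- Let P and Q be finite sets of prime numbers such that every element of P is strictly less than every element of Q, and let A = {p·q : p ∈ P, q ∈ Q}. Then every multiplicative Sidon subset E ⊆ A satisfies |E|² ≤ |Q|·(|E| + |P|²). -/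
open Finset Pointwise

/-- A Kővári–Sós–Turán type bound: if no two distinct members of a family of subsets of `P` share
two elements, then the total size of the family is controlled by Cauchy–Schwarz. -/
theorem sq_sum_card_le_of_pairwiseDisjoint_offDiag {α β : Type*} [DecidableEq α]
    {P : Finset α} {Q : Finset β} {N : β → Finset α} (hN : ∀ q ∈ Q, N q ⊆ P)
    (hdisj : (Q : Set β).PairwiseDisjoint fun q => (N q).offDiag) :
    (∑ q ∈ Q, (N q).card) ^ 2 ≤ Q.card * (∑ q ∈ Q, (N q).card + P.card ^ 2) := by
  classical
  have hoff : ∑ q ∈ Q, (N q).offDiag.card ≤ P.card ^ 2 := by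
    rw [← Finset.card_biUnion hdisj, sq, ← Finset.card_product]
    refine Finset.card_le_card fun x hx => ?_
    obtain ⟨q, hq, hx⟩ := Finset.mem_biUnion.1 hx
    rw [Finset.mem_offDiag] at hx
    exact Finset.mem_product.2 ⟨hN q hq hx.1, hN q hq hx.2.1⟩
  have hsq : ∑ q ∈ Q, (N q).card ^ 2
      = ∑ q ∈ Q, (N q).card + ∑ q ∈ Q, (N q).offDiag.card := by
    rw [← Finset.sum_add_distrib]
    refine Finset.sum_congr rfl fun q _ => ?_
    rw [Finset.offDiag_card, sq, Nat.add_sub_cancel' (Nat.le_mul_self _)]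
  calc (∑ q ∈ Q, (N q).card) ^ 2 ≤ Q.card * ∑ q ∈ Q, (N q).card ^ 2 :=
        sq_sum_le_card_mul_sum_sq
    _ ≤ _ := by rw [hsq]; gcongr

theorem Nat.Prime.eq_and_eq_of_mul_eq_mul {p q p' q' : ℕ} (hp : p.Prime) (hp' : p'.Prime)
    (hq' : q'.Prime) (hne : p ≠ q') (h : p * q = p' * q') : p = p' ∧ q = q' := by
  have hpp : p = p' := by
    rcases hp.dvd_mul.1 (h ▸ dvd_mul_right p q) with hd | hd
    · exact (Nat.prime_dvd_prime_iff_eq hp hp').1 hd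
    · exact absurd ((Nat.prime_dvd_prime_iff_eq hp hq').1 hd) hne
  subst hpp
  exact ⟨rfl, Nat.eq_of_mul_eq_mul_left hp.pos h⟩

theorem stmt7 (P Q : Finset ℕ)
    (hP : ∀ p ∈ P, Nat.Prime p) (hQ : ∀ q ∈ Q, Nat.Prime q)
    (hPQ : ∀ p ∈ P, ∀ q ∈ Q, p < q)
    (E : Finset ℕ) (hE : E ⊆ P * Q) (hSidon : IsMulSidon E) :
    E.card ^ 2 ≤ Q.card * (E.card + P.card ^ 2) := by
  set N : ℕ → Finset ℕ := fun q => {p ∈ P | p * q ∈ E} with hN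
  have hcard : ∑ q ∈ Q, (N q).card = E.card := by
    rw [← Finset.card_sigma]
    refine Finset.card_bij (fun x _ => x.2 * x.1) ?_ ?_ ?_
    · rintro ⟨q, p⟩ h
      simp only [hN, Finset.mem_sigma, Finset.mem_filter] at h
      exact h.2.2
    · rintro ⟨q, p⟩ h ⟨q', p'⟩ h' heq
      simp only [hN, Finset.mem_sigma, Finset.mem_filter] at h h'
      obtain ⟨rfl, rfl⟩ := (hP p h.2.1).eq_and_eq_of_mul_eq_mul (hP p' h'.2.1) (hQ q' h'.1)
        (hPQ p h.2.1 q' h'.1).ne heq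
      rfl
    · intro e he
      obtain ⟨p, hp, q, hq, rfl⟩ := Finset.mem_mul.1 (hE he)
      exact ⟨⟨q, p⟩, by simp [hN, hp, hq, he], rfl⟩
  rw [← hcard]
  refine sq_sum_card_le_of_pairwiseDisjoint_offDiag (fun q _ => Finset.filter_subset _ _) ?_
  intro q hq q' hq' hne
  refine Finset.disjoint_left.2 ?_
  rintro ⟨p, p'⟩ h h'
  simp only [hN, Finset.mem_offDiag, Finset.mem_filter] at h h'
  obtain ⟨⟨hp, hpq⟩, ⟨-, hpq'⟩, hpp⟩ := h
  have hset := hSidon _ hpq _ h'.2.1.2 _ h'.1.2 _ hpq' (by ring)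
  have hmem : p * q ∈ ({p * q', p' * q} : Finset ℕ) := hset ▸ Finset.mem_insert_self _ _
  rcases Finset.mem_insert.1 hmem with heq | heq
  · exact hne (Nat.eq_of_mul_eq_mul_left (hP p hp).pos heq)
  · exact hpp (Nat.eq_of_mul_eq_mul_right (hQ q hq).pos (Finset.mem_singleton.1 heq))
end

section
/- There exists a constant c > 0 such that for every finite nonempty set A ⊂ ℝ there is a subset A'' ⊆ A with |A''| ≥ c·|A|^{4/3}/E₊(A)^{1/3} and E₊(A'') < 2|A''|². -/
open Finset

open scoped Classical in
/-- `EAdd A` is the number of ordered quadruples `(a,b,c,d) ∈ A⁴` with `a + b = c + d`. -/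
noncomputable def EAdd (A : Finset ℝ) : ℕ :=
  ((A ×ˢ A ×ˢ A ×ˢ A).filter fun x => x.1 + x.2.1 = x.2.2.1 + x.2.2.2).card

/-- In the `p`-random subset model, the event `S ⊆ B` has probability `p ^ #S`. -/
theorem sum_powerset_filter_superset {α : Type*} [DecidableEq α] (V S : Finset α) (hS : S ⊆ V)
    (p : ℝ) :
    ∑ B ∈ V.powerset with S ⊆ B, p ^ #B * (1 - p) ^ (#V - #B) = p ^ #S := by
  have key : ∑ B ∈ V.powerset with S ⊆ B, p ^ #B * (1 - p) ^ (#V - #B)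
      = ∑ C ∈ (V \ S).powerset, p ^ #S * (p ^ #C * (1 - p) ^ (#(V \ S) - #C)) := by
    refine sum_nbij' (fun B => B \ S) (fun C => S ∪ C) ?_ ?_ ?_ ?_ ?_
    · intro B hB
      simp only [mem_filter, mem_powerset] at hB ⊢
      exact sdiff_subset_sdiff hB.1 subset_rfl
    · intro C hC
      simp only [mem_filter, mem_powerset] at hC ⊢
      exact ⟨union_subset hS (hC.trans sdiff_subset), subset_union_left⟩
    · intro B hB
      exact union_sdiff_of_subset (mem_filter.1 hB).2
    · intro C hC
      exact union_sdiff_cancel_left (disjoint_sdiff.mono_right (mem_powerset.1 hC))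
    · intro B hB
      simp only [mem_filter, mem_powerset] at hB
      have h1 := card_sdiff_add_card_eq_card hB.2
      have h2 := card_sdiff_add_card_eq_card hS
      rw [← mul_assoc, ← pow_add]
      congr 2 <;> omega
  rw [key, ← mul_sum, sum_pow_mul_eq_add_pow]
  simp

/-- The deletion method: a hypergraph on `V` with edges `S x ∋ f x`, `x ∈ F`, has an independent
set of size at least `p #V - ∑ p ^ #(S x)`. -/
theorem exists_independent_card_ge {α ι : Type*} [DecidableEq α] (V : Finset α)
    (F : Finset ι) (S : ι → Finset α) (hS : ∀ x ∈ F, S x ⊆ V) (f : ι → α) (hf : ∀ x ∈ F, f x ∈ S x)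
    {p : ℝ} (hp0 : 0 ≤ p) (hp1 : p ≤ 1) :
    ∃ I ⊆ V, (∀ x ∈ F, ¬ S x ⊆ I) ∧ p * #V - ∑ x ∈ F, p ^ #(S x) ≤ #I := by
  classical
  set w : Finset α → ℝ := fun B => p ^ #B * (1 - p) ^ (#V - #B) with hw
  have hw0 : ∀ B, 0 ≤ w B := fun B =>
    mul_nonneg (pow_nonneg hp0 _) (pow_nonneg (sub_nonneg.2 hp1) _)
  have hw1 : ∑ B ∈ V.powerset, w B = 1 := by
    rw [hw, sum_pow_mul_eq_add_pow]; simp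
  have hcard : ∑ B ∈ V.powerset, w B * #B = p * #V := by
    have h : ∀ B ∈ V.powerset, w B * #B = ∑ v ∈ V, if {v} ⊆ B then w B else 0 := by
      intro B hB
      simp only [singleton_subset_iff]
      rw [← sum_filter, filter_mem_eq_inter, inter_eq_right.2 (mem_powerset.1 hB), sum_const,
        nsmul_eq_mul, mul_comm]
    rw [sum_congr rfl h, sum_comm]
    calc _ = ∑ v ∈ V, p := by
          refine sum_congr rfl fun v hv => ?_
          rw [← sum_filter, hw, sum_powerset_filter_superset V {v} (by simpa using hv)]
          simp
      _ = p * #V := by rw [sum_const, nsmul_eq_mul, mul_comm]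
  have hbad : ∑ B ∈ V.powerset, w B * #{x ∈ F | S x ⊆ B} = ∑ x ∈ F, p ^ #(S x) := by
    have h : ∀ B ∈ V.powerset, w B * #{x ∈ F | S x ⊆ B}
        = ∑ x ∈ F, if S x ⊆ B then w B else 0 := by
      intro B _
      rw [← sum_filter, sum_const, nsmul_eq_mul, mul_comm]
    rw [sum_congr rfl h, sum_comm]
    refine sum_congr rfl fun x hx => ?_
    rw [← sum_filter, hw, sum_powerset_filter_superset V (S x) (hS x hx)]
  obtain ⟨B, hBV, hB⟩ : ∃ B ∈ V.powerset,
      p * #V - ∑ x ∈ F, p ^ #(S x) ≤ (#B : ℝ) - #{x ∈ F | S x ⊆ B} := by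
    by_contra! hcon
    set M := p * #V - ∑ x ∈ F, p ^ #(S x) with hM
    have hzero : ∑ B ∈ V.powerset, w B * (M - ((#B : ℝ) - #{x ∈ F | S x ⊆ B})) = 0 := by
      simp only [mul_sub, sum_sub_distrib, ← sum_mul]
      rw [hw1, hcard, hbad, hM]; ring
    have hall := (sum_eq_zero_iff_of_nonneg fun B hB =>
      mul_nonneg (hw0 B) (sub_pos.2 (hcon B hB)).le).1 hzero
    have : ∑ B ∈ V.powerset, w B = 0 := sum_eq_zero fun B hB =>
      (mul_eq_zero.1 (hall B hB)).resolve_right (sub_pos.2 (hcon B hB)).ne'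
    linarith
  rw [mem_powerset] at hBV
  refine ⟨B \ ({x ∈ F | S x ⊆ B}.image f), sdiff_subset.trans hBV, fun x hx hsub => ?_, ?_⟩
  · have h1 := mem_sdiff.1 (hsub (hf x hx))
    exact h1.2 (mem_image_of_mem f (mem_filter.2 ⟨hx, hsub.trans sdiff_subset⟩))
  · have h1 : #B ≤ #(B \ ({x ∈ F | S x ⊆ B}.image f)) + #{x ∈ F | S x ⊆ B} := by
      have h2 := le_card_sdiff ({x ∈ F | S x ⊆ B}.image f) B
      have h3 : #({x ∈ F | S x ⊆ B}.image f) ≤ #{x ∈ F | S x ⊆ B} := card_image_le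
      omega
    have h2 : (#B : ℝ) ≤ #(B \ ({x ∈ F | S x ⊆ B}.image f)) + #{x ∈ F | S x ⊆ B} := by
      exact_mod_cast h1
    linarith

/-- A Sidon set has additive energy less than `2 #B ^ 2`. -/
theorem EAdd_lt_of_sidon {B : Finset ℝ} (hB : B.Nonempty)
    (h : ∀ a ∈ B, ∀ b ∈ B, ∀ c ∈ B, ∀ d ∈ B, a + b = c + d → a = c ∨ a = d) :
    EAdd B < 2 * #B ^ 2 := by
  classical
  have hsub : ((B ×ˢ B ×ˢ B ×ˢ B).filter fun x => x.1 + x.2.1 = x.2.2.1 + x.2.2.2) ⊆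
      (B ×ˢ B).image (fun y => (y.1, y.2, y.1, y.2)) ∪
        B.offDiag.image (fun y => (y.1, y.2, y.2, y.1)) := by
    rintro ⟨a, b, c, d⟩ hx
    simp only [mem_filter, mem_product] at hx
    obtain ⟨⟨ha, hb, hc, hd⟩, he⟩ := hx
    simp only [mem_union, mem_image, mem_product, mem_offDiag, Prod.exists, Prod.mk.injEq]
    by_cases hac : a = c
    · exact Or.inl ⟨a, b, ⟨ha, hb⟩, rfl, rfl, hac, by linarith⟩
    · have had : a = d := (h a ha b hb c hc d hd he).resolve_left hac
      have hbc : b = c := by linarith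
      exact Or.inr ⟨a, b, ⟨ha, hb, fun hab => hac (hab.trans hbc)⟩, rfl, rfl, hbc, had⟩
  have h1 := (card_le_card hsub).trans (card_union_le _ _)
  have h2 : #((B ×ˢ B).image (fun y => (y.1, y.2, y.1, y.2))) ≤ #B * #B :=
    card_image_le.trans (card_product B B).le
  have h3 : #(B.offDiag.image (fun y => (y.1, y.2, y.2, y.1))) ≤ #B * #B - #B :=
    card_image_le.trans (offDiag_card B).le
  have h4 : EAdd B ≤ #B * #B + (#B * #B - #B) := by
    unfold EAdd
    convert h1.trans (add_le_add h2 h3)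
  have h5 := hB.card_pos
  have h6 : #B ≤ #B * #B := Nat.le_mul_self _
  rw [pow_two]
  omega

theorem sum_card_sq_le_EAdd (A : Finset ℝ) :
    ∑ a ∈ A, #{y ∈ A ×ˢ A | y.1 + y.2 = a + a} ^ 2 ≤ EAdd A := by
  classical
  have h : ∑ a ∈ A, #{y ∈ A ×ˢ A | y.1 + y.2 = a + a} ^ 2
      = #(A.sigma fun a => {y ∈ A ×ˢ A | y.1 + y.2 = a + a} ×ˢ
          {y ∈ A ×ˢ A | y.1 + y.2 = a + a}) := by
    simp only [card_sigma, card_product, pow_two]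
  rw [h]
  unfold EAdd
  refine card_le_card_of_injOn (fun z => (z.2.1.1, z.2.1.2, z.2.2.1, z.2.2.2)) ?_ ?_
  · rintro ⟨a, ⟨b, c⟩, ⟨d, e⟩⟩ hz
    simp only [coe_sigma, Set.mem_sigma_iff, mem_coe, mem_product, mem_filter, coe_filter,
      Set.mem_ofPred_eq] at hz ⊢
    exact ⟨⟨hz.2.1.1.1, hz.2.1.1.2, hz.2.2.1.1, hz.2.2.1.2⟩, hz.2.1.2.trans hz.2.2.2.symm⟩
  · rintro ⟨a, ⟨b, c⟩, ⟨d, e⟩⟩ hz ⟨a', ⟨b', c'⟩, ⟨d', e'⟩⟩ hz' heq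
    simp only [coe_sigma, Set.mem_sigma_iff, mem_coe, mem_product, mem_filter] at hz hz'
    simp only [Prod.mk.injEq] at heq
    obtain ⟨rfl, rfl, rfl, rfl⟩ := heq
    obtain rfl : a = a' := by linarith [hz.2.1.2, hz'.2.1.2]
    rfl

/-- Weighted count of three-term progressions, controlled by the energy. -/
theorem pow_three_mul_sum_le (A : Finset ℝ) (p : ℝ) :
    2 * (p ^ 3 * ∑ a ∈ A, (#{y ∈ A ×ˢ A | y.1 + y.2 = a + a} : ℝ))
      ≤ p ^ 4 * EAdd A + p ^ 2 * #A := by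
  have h : ((∑ a ∈ A, #{y ∈ A ×ˢ A | y.1 + y.2 = a + a} ^ 2 : ℕ) : ℝ) ≤ EAdd A := by
    exact_mod_cast sum_card_sq_le_EAdd A
  push_cast at h
  calc 2 * (p ^ 3 * ∑ a ∈ A, (#{y ∈ A ×ˢ A | y.1 + y.2 = a + a} : ℝ))
      = ∑ a ∈ A, 2 * (p ^ 3 * (#{y ∈ A ×ˢ A | y.1 + y.2 = a + a} : ℝ)) := by
        rw [mul_sum, mul_sum]
    _ ≤ ∑ a ∈ A, (p ^ 4 * (#{y ∈ A ×ˢ A | y.1 + y.2 = a + a} : ℝ) ^ 2 + p ^ 2) := by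
        refine sum_le_sum fun a _ => ?_
        nlinarith [sq_nonneg (p ^ 2 * (#{y ∈ A ×ˢ A | y.1 + y.2 = a + a} : ℝ) - p)]
    _ = p ^ 4 * ∑ a ∈ A, (#{y ∈ A ×ˢ A | y.1 + y.2 = a + a} : ℝ) ^ 2 + p ^ 2 * #A := by
        rw [sum_add_distrib, ← mul_sum, sum_const, nsmul_eq_mul]; ring
    _ ≤ _ := by gcongr

theorem three_le_card_of_nontrivial {a b c d : ℝ} (h : a + b = c + d) (hac : a ≠ c)
    (had : a ≠ d) :
    3 ≤ #({a, b, c, d} : Finset ℝ) ∧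
      (a ≠ b → c ≠ d → #({a, b, c, d} : Finset ℝ) = 4) := by
  have hbc : b ≠ c := fun e => had (by linarith)
  have hbd : b ≠ d := fun e => hac (by linarith)
  by_cases hab : a = b
  · have hcd : c ≠ d := fun e => hac (by linarith)
    subst hab
    refine ⟨?_, fun h => absurd rfl h⟩
    simp [hac, had, hcd]
  · by_cases hcd : c = d
    · subst hcd
      refine ⟨?_, fun _ h => absurd rfl h⟩
      simp [hac, hab, hbc]
    · have : #({a, b, c, d} : Finset ℝ) = 4 := by simp [hac, had, hab, hbc, hbd, hcd]
      exact ⟨by omega, fun _ _ => this⟩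

/-- Random sparsification of `A` to a Sidon set. -/
theorem exists_sidon_card_ge (A : Finset ℝ) {p : ℝ} (hp0 : 0 ≤ p) (hp1 : p ≤ 1) :
    ∃ B ⊆ A, (∀ a ∈ B, ∀ b ∈ B, ∀ c ∈ B, ∀ d ∈ B, a + b = c + d → a = c ∨ a = d) ∧
      p * #A - (2 * p ^ 4 * EAdd A + p ^ 2 * #A) ≤ #B := by
  classical
  set Q := (A ×ˢ A ×ˢ A ×ˢ A).filter fun x => x.1 + x.2.1 = x.2.2.1 + x.2.2.2 with hQ
  have hQE : #Q = EAdd A := by unfold EAdd; rw [hQ]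
  set F := Q.filter fun x => x.1 ≠ x.2.2.1 ∧ x.1 ≠ x.2.2.2 with hF
  have hmem : ∀ a b c d : ℝ, (a, b, c, d) ∈ F ↔
      ((a ∈ A ∧ b ∈ A ∧ c ∈ A ∧ d ∈ A) ∧ a + b = c + d) ∧ a ≠ c ∧ a ≠ d := by
    intro a b c d
    simp [hF, hQ, and_assoc]
  set S : ℝ × ℝ × ℝ × ℝ → Finset ℝ := fun x => {x.1, x.2.1, x.2.2.1, x.2.2.2} with hSdef
  obtain ⟨B, hBA, hind, hcard⟩ := exists_independent_card_ge A F S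
    (by
      rintro ⟨a, b, c, d⟩ hx
      obtain ⟨⟨⟨ha, hb, hc, hd⟩, -⟩, -⟩ := (hmem a b c d).1 hx
      simp [hSdef, insert_subset_iff, ha, hb, hc, hd])
    Prod.fst (fun x _ => by simp [hSdef]) hp0 hp1
  refine ⟨B, hBA, ?_, ?_⟩
  · intro a ha b hb c hc d hd he
    by_contra! hne
    refine hind (a, b, c, d) ((hmem a b c d).2
      ⟨⟨⟨hBA ha, hBA hb, hBA hc, hBA hd⟩, he⟩, hne⟩) ?_
    simp [hSdef, insert_subset_iff, ha, hb, hc, hd]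
  · have hdeg1 : #{x ∈ Q | x.1 = x.2.1} ≤ ∑ a ∈ A, #{y ∈ A ×ˢ A | y.1 + y.2 = a + a} := by
      rw [← card_sigma]
      refine card_le_card_of_injOn (fun x => ⟨x.1, x.2.2⟩) ?_ ?_
      · rintro ⟨a, b, c, d⟩ hx
        simp only [hQ, mem_coe, mem_filter, mem_product, mem_sigma] at hx ⊢
        obtain ⟨⟨⟨ha, hb, hc, hd⟩, he⟩, rfl⟩ := hx
        exact ⟨ha, ⟨hc, hd⟩, he.symm⟩
      · rintro ⟨a, b, c, d⟩ hx ⟨a', b', c', d'⟩ hx' heq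
        simp only [mem_coe, mem_filter] at hx hx'
        simp only [Sigma.mk.injEq, heq_eq_eq, Prod.mk.injEq] at heq ⊢
        exact ⟨heq.1, by rw [← hx.2, ← hx'.2, heq.1], heq.2⟩
    have hdeg2 : #{x ∈ Q | x.2.2.1 = x.2.2.2}
        ≤ ∑ a ∈ A, #{y ∈ A ×ˢ A | y.1 + y.2 = a + a} := by
      rw [← card_sigma]
      refine card_le_card_of_injOn (fun x => ⟨x.2.2.1, (x.1, x.2.1)⟩) ?_ ?_
      · rintro ⟨a, b, c, d⟩ hx
        simp only [hQ, mem_coe, mem_filter, mem_product, mem_sigma] at hx ⊢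
        obtain ⟨⟨⟨ha, hb, hc, hd⟩, he⟩, rfl⟩ := hx
        exact ⟨hc, ⟨ha, hb⟩, he⟩
      · rintro ⟨a, b, c, d⟩ hx ⟨a', b', c', d'⟩ hx' heq
        simp only [mem_coe, mem_filter] at hx hx'
        simp only [Sigma.mk.injEq, heq_eq_eq, Prod.mk.injEq] at heq ⊢
        exact ⟨heq.2.1, heq.2.2, heq.1, by rw [← hx.2, ← hx'.2, heq.1]⟩
    have hterm : ∀ x ∈ F, p ^ #(S x) ≤ p ^ 4 + ((if x.1 = x.2.1 then p ^ 3 else 0)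
        + (if x.2.2.1 = x.2.2.2 then p ^ 3 else 0)) := by
      rintro ⟨a, b, c, d⟩ hx
      obtain ⟨⟨-, he⟩, hac, had⟩ := (hmem a b c d).1 hx
      obtain ⟨h3, h4⟩ := three_le_card_of_nontrivial he hac had
      have hle : p ^ #(S (a, b, c, d)) ≤ p ^ 3 := pow_le_pow_of_le_one hp0 hp1 h3
      have hp3 : 0 ≤ p ^ 3 := pow_nonneg hp0 3
      have hp4 : 0 ≤ p ^ 4 := pow_nonneg hp0 4
      by_cases hab : a = b
      · simp only [hab, if_true] at hle ⊢
        split_ifs <;> linarith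
      · by_cases hcd : c = d
        · simp only [hcd, if_true] at hle ⊢
          split_ifs; linarith
        · have : #(S (a, b, c, d)) = 4 := h4 hab hcd
          simp [this, hab, hcd]
    have hsum : ∑ x ∈ F, p ^ #(S x) ≤ 2 * p ^ 4 * EAdd A + p ^ 2 * #A := by
      have hd1 : (#{x ∈ Q | x.1 = x.2.1} : ℝ)
          ≤ ∑ a ∈ A, (#{y ∈ A ×ˢ A | y.1 + y.2 = a + a} : ℝ) := by exact_mod_cast hdeg1
      have hd2 : (#{x ∈ Q | x.2.2.1 = x.2.2.2} : ℝ)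
          ≤ ∑ a ∈ A, (#{y ∈ A ×ˢ A | y.1 + y.2 = a + a} : ℝ) := by exact_mod_cast hdeg2
      have hp3 : 0 ≤ p ^ 3 := pow_nonneg hp0 3
      calc ∑ x ∈ F, p ^ #(S x)
          ≤ ∑ x ∈ F, (p ^ 4 + ((if x.1 = x.2.1 then p ^ 3 else 0)
            + (if x.2.2.1 = x.2.2.2 then p ^ 3 else 0))) := sum_le_sum hterm
        _ ≤ ∑ x ∈ Q, (p ^ 4 + ((if x.1 = x.2.1 then p ^ 3 else 0)
            + (if x.2.2.1 = x.2.2.2 then p ^ 3 else 0))) :=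
          sum_le_sum_of_subset_of_nonneg (filter_subset _ _) fun x _ _ => by positivity
        _ = p ^ 4 * EAdd A + (p ^ 3 * #{x ∈ Q | x.1 = x.2.1}
            + p ^ 3 * #{x ∈ Q | x.2.2.1 = x.2.2.2}) := by
          rw [sum_add_distrib, sum_add_distrib, ← sum_filter, ← sum_filter, sum_const,
            sum_const, sum_const, hQE]
          simp only [nsmul_eq_mul]
          ring
        _ ≤ 2 * (p ^ 3 * ∑ a ∈ A, (#{y ∈ A ×ˢ A | y.1 + y.2 = a + a} : ℝ))
            + p ^ 4 * EAdd A := by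
          linarith [mul_le_mul_of_nonneg_left hd1 hp3, mul_le_mul_of_nonneg_left hd2 hp3]
        _ ≤ _ := by linarith [pow_three_mul_sum_le A p]
    linarith

theorem card_le_EAdd (A : Finset ℝ) : #A ≤ EAdd A := by
  classical
  unfold EAdd
  refine card_le_card_of_injOn (fun a => (a, a, a, a)) ?_ ?_
  · intro a ha
    simp only [mem_coe] at ha
    simp [ha]
  · intro a _ b _ h
    exact (Prod.mk.inj h).1

theorem stmt10 :
    ∃ c : ℝ, 0 < c ∧ ∀ A : Finset ℝ, A.Nonempty →
      ∃ A'' ⊆ A, c * (A.card : ℝ) ^ ((4 : ℝ) / 3) / (EAdd A : ℝ) ^ ((1 : ℝ) / 3)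
          ≤ (A''.card : ℝ) ∧
        EAdd A'' < 2 * A''.card ^ 2 := by
  refine ⟨1 / 8, by norm_num, fun A hA => ?_⟩
  have hN : (0 : ℝ) < #A := by exact_mod_cast hA.card_pos
  have hNE : (#A : ℝ) ≤ EAdd A := by exact_mod_cast card_le_EAdd A
  have hE : (0 : ℝ) < EAdd A := hN.trans_le hNE
  set q : ℝ := ((#A : ℝ) / EAdd A) ^ ((1 : ℝ) / 3) with hq
  have hq0 : 0 < q := Real.rpow_pos_of_pos (div_pos hN hE) _
  have hq1 : q ≤ 1 :=
    Real.rpow_le_one (div_pos hN hE).le ((div_le_one hE).2 hNE) (by norm_num)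
  have hq3 : q ^ 3 * EAdd A = #A := by
    rw [hq, ← Real.rpow_natCast, ← Real.rpow_mul (div_pos hN hE).le]
    norm_num
    field_simp
  have hsize : (1 / 8 : ℝ) * (#A : ℝ) ^ ((4 : ℝ) / 3) / (EAdd A : ℝ) ^ ((1 : ℝ) / 3)
      = 1 / 8 * (q * #A) := by
    have h : (#A : ℝ) ^ ((4 : ℝ) / 3) = (#A : ℝ) ^ ((1 : ℝ) / 3) * #A := by
      rw [← Real.rpow_add_one hN.ne']; norm_num
    rw [hq, Real.div_rpow hN.le hE.le, h]
    ring
  obtain ⟨B, hBA, hsidon, hcard⟩ :=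
    exists_sidon_card_ge A (p := q / 2) (by positivity) (by linarith)
  have hlow : 1 / 8 * (q * #A) ≤ (#B : ℝ) := by
    refine le_trans ?_ hcard
    have h4 : 2 * (q / 2) ^ 4 * EAdd A = 1 / 8 * (q * #A) := by
      rw [← hq3]; ring
    have h2 : q ^ 2 * #A ≤ q * #A := by
      gcongr
      nlinarith
    rw [h4]
    nlinarith
  have hBpos : (0 : ℝ) < #B := lt_of_lt_of_le (by positivity) hlow
  have hB : B.Nonempty := card_pos.1 (by exact_mod_cast hBpos)
  exact ⟨B, hBA, hsize.trans_le hlow, EAdd_lt_of_sidon hB hsidon⟩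
end

section
/- There exists a constant C > 0 such that for every natural number N ≥ 1, the set A = {(2i−1)·2^j : 1 ≤ i ≤ N², 1 ≤ j ≤ N} has the property that every subset A' ⊆ A with |A'| ≥ C·N^{5/2} satisfies Eˣ(A') ≥ 2|A'|²; that is, tˣ(A) ≤ C·N^{5/2} = C·|A|^{5/6}. -/
open Finset

/-- `EMul A` is the number of ordered quadruples `(a,b,c,d) ∈ A⁴` with `a * b = c * d`. -/
def EMul (A : Finset ℕ) : ℕ :=
  ((A ×ˢ A ×ˢ A ×ˢ A).filter fun x => x.1 * x.2.1 = x.2.2.1 * x.2.2.2).card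

/-- `tMul A` is the size of the largest subset `A' ⊆ A` with `Eˣ(A') < 2|A'|²`. -/
def tMul (A : Finset ℕ) : ℕ :=
  (A.powerset.filter fun S => EMul S < 2 * S.card ^ 2).sup Finset.card

/-- Cauchy–Schwarz lower bound for the number of collisions of a map between finite sets. -/
theorem card_sq_le_card_mul_card_collisions {α β : Type*} [DecidableEq β]
    {s : Finset α} {t : Finset β} {f : α → β} (hf : ∀ x ∈ s, f x ∈ t) :
    s.card ^ 2 ≤ t.card * ((s ×ˢ s).filter fun p => f p.1 = f p.2).card := by
  have hcoll : ((s ×ˢ s).filter fun p => f p.1 = f p.2).card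
      = ∑ b ∈ t, (s.filter fun x => f x = b).card ^ 2 := by
    rw [card_eq_sum_card_fiberwise (f := fun p => f p.1) (t := t)]
    · refine sum_congr rfl fun b _ => ?_
      rw [sq, ← card_product]
      congr 1
      ext p
      simp only [mem_filter, mem_product]
      grind
    · intro p hp
      simp only [coe_filter, mem_product, Set.mem_ofPred_eq] at hp
      exact hf _ hp.1.1
  rw [hcoll, card_eq_sum_card_fiberwise (f := f) (t := t) hf]
  exact sq_sum_le_card_mul_sum_sq

theorem card_pow_four_le_mul_EMul {N : ℕ} {S : Finset ℕ}
    (hS : S ⊆ (Icc 1 (N ^ 2) ×ˢ Icc 1 N).image fun x : ℕ × ℕ => (2 * x.1 - 1) * 2 ^ x.2) :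
    S.card ^ 4 ≤ 2 * N ^ 5 * EMul S := by
  have hrep : ∀ a ∈ S, ∃ p : ℕ × ℕ,
      p ∈ Icc 1 (N ^ 2) ×ˢ Icc 1 N ∧ (2 * p.1 - 1) * 2 ^ p.2 = a :=
    fun a ha => mem_image.1 (hS ha)
  choose! p hp hpa using hrep
  have hcs := card_sq_le_card_mul_card_collisions (s := S ×ˢ S)
    (t := Icc 1 (N ^ 2) ×ˢ Icc 1 (N ^ 2) ×ˢ Icc 1 (2 * N))
    (f := fun x => ((p x.1).1, (p x.2).1, (p x.1).2 + (p x.2).2)) (by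
      rintro ⟨a, b⟩ hab
      obtain ⟨ha, hb⟩ := mem_product.1 hab
      have h₁ := hp a ha
      have h₂ := hp b hb
      simp only [mem_product, mem_Icc] at h₁ h₂ ⊢
      lia)
  have hcoll : (((S ×ˢ S) ×ˢ (S ×ˢ S)).filter fun x =>
      ((p x.1.1).1, (p x.1.2).1, (p x.1.1).2 + (p x.1.2).2)
        = ((p x.2.1).1, (p x.2.2).1, (p x.2.1).2 + (p x.2.2).2)).card ≤ EMul S := by
    refine card_le_card_of_injOn (fun x => (x.1.1, x.1.2, x.2.1, x.2.2)) ?_ ?_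
    · rintro ⟨⟨a, b⟩, c, d⟩ h
      simp only [coe_filter, mem_product, Set.mem_ofPred_eq, Prod.mk.injEq] at h ⊢
      obtain ⟨⟨⟨ha, hb⟩, hc, hd⟩, h₁, h₂, h₃⟩ := h
      refine ⟨⟨ha, hb, hc, hd⟩, ?_⟩
      rw [← hpa a ha, ← hpa b hb, ← hpa c hc, ← hpa d hd, h₁, h₂, mul_mul_mul_comm,
        ← pow_add, h₃, pow_add, mul_mul_mul_comm]
    · rintro ⟨⟨a, b⟩, c, d⟩ _ ⟨⟨a', b'⟩, c', d'⟩ _ h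
      simp only [Prod.mk.injEq] at h ⊢
      tauto
  simp only [card_product, Nat.card_Icc, Nat.add_sub_cancel] at hcs
  calc S.card ^ 4 = (S.card * S.card) ^ 2 := by ring
    _ ≤ _ := hcs
    _ ≤ N ^ 2 * (N ^ 2 * (2 * N)) * EMul S := Nat.mul_le_mul_left _ hcoll
    _ = 2 * N ^ 5 * EMul S := by ring

theorem injOn_odd_mul_two_pow (s : Set ℕ) :
    Set.InjOn (fun x : ℕ × ℕ => (2 * x.1 - 1) * 2 ^ x.2) (Set.Ici 1 ×ˢ s) := by
  rintro ⟨i, j⟩ ⟨hi, -⟩ ⟨i', j'⟩ ⟨hi', -⟩ h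
  simp only [Set.mem_Ici] at hi hi'
  have hval : ∀ m k : ℕ, 1 ≤ m → padicValNat 2 ((2 * m - 1) * 2 ^ k) = k := by
    intro m k hm
    rw [padicValNat.mul (by lia) (by positivity), padicValNat.prime_pow,
      padicValNat.eq_zero_of_not_dvd (by lia), zero_add]
  have hj : j = j' := by
    rw [← hval i j hi, ← hval i' j' hi']
    exact congrArg (padicValNat 2) h
  subst hj
  have := Nat.eq_of_mul_eq_mul_right (by positivity) h
  simp only [Prod.mk.injEq, and_true]
  lia

theorem two_mul_card_sq_le_EMul {N : ℕ} (hN : 1 ≤ N) {S : Finset ℕ}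
    (hS : S ⊆ (Icc 1 (N ^ 2) ×ˢ Icc 1 N).image fun x : ℕ × ℕ => (2 * x.1 - 1) * 2 ^ x.2)
    (hcard : 2 * (N : ℝ) ^ ((5 : ℝ) / 2) ≤ (S.card : ℝ)) :
    2 * S.card ^ 2 ≤ EMul S := by
  have hsq : 4 * N ^ 5 ≤ S.card ^ 2 := by
    have hpow : ((N : ℝ) ^ ((5 : ℝ) / 2)) ^ 2 = (N : ℝ) ^ 5 := by
      rw [← Real.rpow_natCast, ← Real.rpow_mul (Nat.cast_nonneg N), ← Real.rpow_natCast]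
      norm_num
    have h := pow_le_pow_left₀ (by positivity) hcard 2
    rw [mul_pow, hpow] at h
    norm_num at h
    exact_mod_cast h
  refine le_of_mul_le_mul_left (a := 2 * N ^ 5) ?_ (by positivity)
  calc 2 * N ^ 5 * (2 * S.card ^ 2) = 4 * N ^ 5 * S.card ^ 2 := by ring
    _ ≤ S.card ^ 2 * S.card ^ 2 := Nat.mul_le_mul_right _ hsq
    _ = S.card ^ 4 := by ring
    _ ≤ 2 * N ^ 5 * EMul S := card_pow_four_le_mul_EMul hS

theorem stmt15 :
    ∃ C : ℝ, 0 < C ∧ ∀ N : ℕ, 1 ≤ N → ∀ A : Finset ℕ,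
      A = ((Finset.Icc 1 (N ^ 2) ×ˢ Finset.Icc 1 N).image
          fun x : ℕ × ℕ => (2 * x.1 - 1) * 2 ^ x.2) →
      (∀ A' ⊆ A, C * (N : ℝ) ^ ((5 : ℝ) / 2) ≤ (A'.card : ℝ) →
        2 * A'.card ^ 2 ≤ EMul A') ∧
      (tMul A : ℝ) ≤ C * (N : ℝ) ^ ((5 : ℝ) / 2) ∧
      C * (N : ℝ) ^ ((5 : ℝ) / 2) = C * (A.card : ℝ) ^ ((5 : ℝ) / 6) := by
  refine ⟨2, two_pos, ?_⟩
  rintro N hN _ rfl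
  refine ⟨fun S hS => two_mul_card_sq_le_EMul hN hS, ?_, ?_⟩
  · rw [← Nat.le_floor_iff (by positivity), tMul, Finset.sup_le_iff]
    intro S hS
    obtain ⟨hSA, hE⟩ := mem_filter.1 hS
    refine Nat.le_floor (le_of_not_ge fun h => ?_)
    exact hE.not_ge (two_mul_card_sq_le_EMul hN (mem_powerset.1 hSA) h)
  · rw [card_image_of_injOn ((injOn_odd_mul_two_pow Set.univ).mono ?_)]
    · rw [card_product, Nat.card_Icc, Nat.card_Icc, Nat.add_sub_cancel, Nat.add_sub_cancel,
        ← pow_succ, Nat.cast_pow, ← Real.rpow_natCast, ← Real.rpow_mul (Nat.cast_nonneg N)]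
      norm_num
    · rintro ⟨i, j⟩ h
      simp only [coe_product, Set.mem_prod, mem_coe, mem_Icc] at h
      exact ⟨h.1.1, Set.mem_univ _⟩
end
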